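/- arXiv:2405.08117 — 4 statements merged into one kernel-verified Lean document; each statement's English description precedes it below -/
import Mathlib

section
/- Core identity of the high-rate seedless extractor theorem (Theorem 3.1, finite-dimensional form): Let m ≤ M be natural numbers, let w ∈ F^M be a fixed vector, and for each u ∈ F^M with h_F(u) < (M−m)/2 let ψ_u ∈ ℂ^N be an arbitrary vector. For x ∈ F^M define φ_x := ∑_{u ∈ F^M, h_F(u) < (M−m)/2} ω^{⟨u+w, x⟩} · ψ_u ∈ ℂ^N. Let R be an m×M matrix over F such that for every subset J ⊆ {1,…,M} of size m, the columns of R indexed by J are linearly independent over F. Then for every y ∈ F^m, ∑_{x ∈ F^M : R·x = y} φ_x φ_x^* = p^{κ(M−m)} · ∑_{u ∈ F^M, h_F(u) < (M−m)/2} ψ_u ψ_u^*, where v v^* denotes the outer product of v ∈ ℂ^N with its conjugate (an N×N complex matrix). In particular the left-hand side does not depend on y, i.e., applying R to the source register after the coordinatewise quantum Fourier transform yields a uniformly random element of F^m that is unentangled from the side-information register. -/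
open Finset

noncomputable section

/-- The `ZMod p`-valued pairing on `F` induced by an additive isomorphism
`φ : F ≃+ (Fin κ → ZMod p)`: `⟨a, b⟩ := ∑ j, φ(a)_j * φ(b)_j`. -/
def pairF {p κ : ℕ} {F : Type*} [AddCommGroup F]
    (φ : F ≃+ (Fin κ → ZMod p)) (a b : F) : ZMod p :=
  ∑ j, φ a j * φ b j

/-- The pairing extended to vectors: `⟨u, x⟩ := ∑ i, ⟨u_i, x_i⟩`. -/
def pairVec {p κ M : ℕ} {F : Type*} [AddCommGroup F]
    (φ : F ≃+ (Fin κ → ZMod p)) (u x : Fin M → F) : ZMod p :=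
  ∑ i, pairF φ (u i) (x i)

/-- The outer product `v v*` of a vector `v ∈ ℂ^N` with its conjugate. -/
def outer {N : ℕ} (v : Fin N → ℂ) : Matrix (Fin N) (Fin N) ℂ :=
  Matrix.of fun a b => v a * (starRingEnd ℂ) (v b)

lemma pairF_add_right {p κ : ℕ} {F : Type*} [AddCommGroup F]
    (φ : F ≃+ (Fin κ → ZMod p)) (a b c : F) :
    pairF φ a (b + c) = pairF φ a b + pairF φ a c := by
  simp [pairF, mul_add, sum_add_distrib]

lemma pairF_sub_left {p κ : ℕ} {F : Type*} [AddCommGroup F]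
    (φ : F ≃+ (Fin κ → ZMod p)) (a b c : F) :
    pairF φ (a - b) c = pairF φ a c - pairF φ b c := by
  simp [pairF, sub_mul]

lemma exists_pairF_ne_zero {p κ : ℕ} [Fact p.Prime] {F : Type*} [AddCommGroup F]
    (φ : F ≃+ (Fin κ → ZMod p)) {a : F} (ha : a ≠ 0) : ∃ c, pairF φ a c ≠ 0 := by
  obtain ⟨j, hj⟩ := Function.ne_iff.mp ((map_ne_zero_iff φ φ.injective).mpr ha)
  exact ⟨φ.symm (Pi.single j 1), by simpa [pairF, Pi.single_apply] using hj⟩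

lemma pairVec_sub_left {p κ M : ℕ} {F : Type*} [AddCommGroup F]
    (φ : F ≃+ (Fin κ → ZMod p)) (u v x : Fin M → F) :
    pairVec φ (u - v) x = pairVec φ u x - pairVec φ v x := by
  simp [pairVec, pairF_sub_left]

/-- The pairing with a fixed vector, as an additive homomorphism. -/
def pairVecHom {p κ M : ℕ} {F : Type*} [AddCommGroup F]
    (φ : F ≃+ (Fin κ → ZMod p)) (u : Fin M → F) : (Fin M → F) →+ ZMod p :=
  AddMonoidHom.mk' (pairVec φ u) fun x y => by
    simp [pairVec, pairF_add_right, sum_add_distrib]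

lemma exists_mulVec_eq_of_linearIndependent {m M : ℕ} {F : Type*} [Field F]
    (R : Matrix (Fin m) (Fin M) F) {J : Finset (Fin M)} (hJ : J.card = m)
    (hR : LinearIndependent F (fun j : J => fun i : Fin m => R i (j : Fin M)))
    (v : Fin m → F) : ∃ z : Fin M → F, (∀ i ∉ J, z i = 0) ∧ R.mulVec z = v := by
  have hspan := hR.span_eq_top_of_card_eq_finrank' (by simp [hJ])
  obtain ⟨c, hc⟩ := (Submodule.mem_span_range_iff_exists_fun F).mp
    (hspan ▸ Submodule.mem_top : v ∈ _)
  refine ⟨fun i => if h : i ∈ J then c ⟨i, h⟩ else 0, fun i hi => by simp [hi], ?_⟩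
  ext k
  rw [← hc, Matrix.mulVec, dotProduct, ← sum_subset (subset_univ J)
    (fun i _ hi => by simp [hi]), ← sum_coe_sort]
  simp [mul_comm]

lemma card_mulVec_fiber {m M : ℕ} {F : Type*} [Field F] [Fintype F] [DecidableEq F]
    (R : Matrix (Fin m) (Fin M) F) (hmM : m ≤ M) (hR : Function.Surjective R.mulVec)
    (y : Fin m → F) :
    Finset.card {x : Fin M → F | R.mulVec x = y} = Fintype.card F ^ (M - m) := by
  have hfib : ∀ y', Finset.card {x : Fin M → F | R.mulVec x = y'} = Finset.card {x : Fin M → F | R.mulVec x = y} :=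
    fun y' => AddMonoidHom.card_fiber_eq_of_mem_range R.mulVecLin.toAddMonoidHom
      (hR y') (hR y)
  have htotal := card_eq_sum_card_fiberwise (f := R.mulVec) (s := univ) (t := univ)
    (fun _ _ => mem_coe.mpr (mem_univ _))
  simp only [hfib, sum_const, card_univ, Fintype.card_fun, Fintype.card_fin, smul_eq_mul]
    at htotal
  have hpos : 0 < Fintype.card F ^ m := pow_pos Fintype.card_pos m
  refine Nat.eq_of_mul_eq_mul_left hpos ?_
  rw [← htotal, ← pow_add, Nat.add_sub_cancel' hmM]

/-- A character nontrivial on the kernel of `R` sums to zero over each fibre of `R`. -/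
lemma sum_addChar_mulVec_fiber_eq_zero {m M : ℕ} {F : Type*} [Field F] [Fintype F]
    [DecidableEq F] (R : Matrix (Fin m) (Fin M) F) (χ : AddChar (Fin M → F) ℂ)
    {z : Fin M → F} (hz : R.mulVec z = 0) (hχ : χ z ≠ 1) (y : Fin m → F) :
    ∑ x with R.mulVec x = y, χ x = 0 := by
  refine eq_zero_of_mul_eq_self_left hχ ?_
  rw [mul_sum]
  refine sum_equiv (Equiv.addLeft z) (fun x => ?_) (fun x _ => ?_)
  · simp [Matrix.mulVec_add, hz]
  · simp [AddChar.map_add_eq_mul]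

lemma exists_mulVec_eq_zero_pairVec_ne_zero {p κ m M : ℕ} [Fact p.Prime] {F : Type*} [Field F]
    [DecidableEq F] (φ : F ≃+ (Fin κ → ZMod p)) (R : Matrix (Fin m) (Fin M) F)
    (hR : ∀ J : Finset (Fin M), J.card = m →
      LinearIndependent F (fun j : J => fun i : Fin m => R i (j : Fin M)))
    {d : Fin M → F} (hd : d ≠ 0) (hdm : hammingNorm d + m ≤ M) :
    ∃ z, R.mulVec z = 0 ∧ pairVec φ d z ≠ 0 := by
  obtain ⟨i₀, hi₀⟩ := Function.ne_iff.mp hd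
  obtain ⟨c, hc⟩ := exists_pairF_ne_zero φ hi₀
  have hzeros : m ≤ Finset.card {i | d i = 0} := by
    have h := card_filter_add_card_filter_not (s := (univ : Finset (Fin M))) (fun i => d i = 0)
    simp only [card_univ, Fintype.card_fin] at h
    simp only [hammingNorm, ne_eq] at hdm
    omega
  obtain ⟨J, hJ, hJm⟩ := exists_subset_card_eq hzeros
  obtain ⟨z, hzJ, hz⟩ := exists_mulVec_eq_of_linearIndependent R hJm (hR J hJm)
    (-R.mulVec (Pi.single i₀ c))
  refine ⟨z + Pi.single i₀ c, by rw [Matrix.mulVec_add, hz, neg_add_cancel], ?_⟩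
  have hi₀J : i₀ ∉ J := fun h => hi₀ (by simpa using hJ h)
  rw [pairVec, sum_eq_single i₀]
  · simpa [hzJ i₀ hi₀J] using hc
  · intro i _ hi
    by_cases hiJ : i ∈ J
    · have : d i = 0 := by simpa using hJ hiJ
      simp [pairF, this]
    · simp [pairF, hzJ i hiJ, hi]
  · simp

/-- Core identity of the high-rate seedless extractor theorem (Theorem 3.1):
with `φ_x := ∑_{u : h_F(u) < (M−m)/2} ω^{⟨u+w, x⟩} • ψ_u`, and `R` an `m × M` matrix
over `F` every `m` of whose columns are linearly independent, for every `y ∈ F^m`,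
`∑_{x : R·x = y} φ_x φ_x* = p^{κ(M−m)} · ∑_{u : h_F(u) < (M−m)/2} ψ_u ψ_u*`;
in particular the left-hand side does not depend on `y`. -/
theorem extractor_identity
    (p κ M m N : ℕ) (hp : p.Prime)
    (F : Type) [Field F] [Fintype F] [DecidableEq F]
    (hcard : Fintype.card F = p ^ κ)
    (hchar : CharP F p)
    (φ : F ≃+ (Fin κ → ZMod p))
    (ω : ℂ) (hω : IsPrimitiveRoot ω p)
    (hmM : m ≤ M)
    (w : Fin M → F)
    (ψ : (Fin M → F) → (Fin N → ℂ))
    (R : Matrix (Fin m) (Fin M) F)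
    (hR : ∀ J : Finset (Fin M), J.card = m →
      LinearIndependent F (fun j : J => fun i : Fin m => R i (j : Fin M)))
    (y : Fin m → F) :
    ∑ x ∈ univ.filter (fun x : Fin M → F => R.mulVec x = y),
      outer (∑ u ∈ univ.filter
          (fun u : Fin M → F => (hammingNorm u : ℝ) < ((M : ℝ) - m) / 2),
        (ω ^ (pairVec φ (u + w) x).val) • ψ u)
    = ((p : ℂ) ^ (κ * (M - m))) •
      ∑ u ∈ univ.filter
          (fun u : Fin M → F => (hammingNorm u : ℝ) < ((M : ℝ) - m) / 2),
        outer (ψ u) := by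
  have : Fact p.Prime := ⟨hp⟩
  have hsum : ∀ u ∈ univ.filter
        (fun u : Fin M → F => (hammingNorm u : ℝ) < ((M : ℝ) - m) / 2),
      ∀ v ∈ univ.filter
        (fun u : Fin M → F => (hammingNorm u : ℝ) < ((M : ℝ) - m) / 2),
      ∑ x with R.mulVec x = y, ω ^ (pairVec φ (u + w) x).val *
        (starRingEnd ℂ) (ω ^ (pairVec φ (v + w) x).val) =
      if u = v then (p : ℂ) ^ (κ * (M - m)) else 0 := by
    intro u hu v hv
    rw [mem_filter_univ] at hu hv
    let χ : AddChar (ZMod p) ℂ := AddChar.zmodChar p hω.pow_eq_one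
    have hχ : ∀ a, ω ^ a.val = χ a := fun a => (AddChar.zmodChar_apply _ a).symm
    have hterm : ∀ x, ω ^ (pairVec φ (u + w) x).val *
        (starRingEnd ℂ) (ω ^ (pairVec φ (v + w) x).val) =
        χ.compAddMonoidHom (pairVecHom φ (u - v)) x := by
      intro x
      rw [hχ, hχ, ← AddChar.map_neg_eq_conj, ← AddChar.map_add_eq_mul, ← sub_eq_add_neg,
        ← pairVec_sub_left, add_sub_add_right_eq_sub]
      rfl
    simp_rw [hterm]
    split_ifs with huv
    · subst huv
      obtain ⟨J, hJ⟩ := exists_subset_card_eq (s := (univ : Finset (Fin M))) (n := m)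
        (by simpa using hmM)
      have hsurj : Function.Surjective R.mulVec := fun v =>
        (exists_mulVec_eq_of_linearIndependent R hJ.2 (hR J hJ.2) v).imp fun _ => And.right
      have hone : ∀ x, χ.compAddMonoidHom (pairVecHom φ (u - u)) x = 1 := fun x => by
        rw [← hterm, hχ, ← AddChar.map_neg_eq_conj, ← AddChar.map_add_eq_mul, add_neg_cancel,
          AddChar.map_zero_eq_one]
      simp_rw [hone]
      simp [card_mulVec_fiber R hmM hsurj, hcard, pow_mul]
    · have hdist : hammingNorm (u - v) ≤ hammingNorm u + hammingNorm v := by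
        have h := hammingDist_triangle v 0 u
        rwa [hammingDist_zero_right, hammingDist_zero_left, hammingDist_eq_hammingNorm,
          neg_add_eq_sub, add_comm] at h
      have hweight : hammingNorm (u - v) + m ≤ M := by
        have : (hammingNorm (u - v) : ℝ) ≤ hammingNorm u + hammingNorm v := mod_cast hdist
        have : (hammingNorm (u - v) : ℝ) + m ≤ M := by linarith
        exact_mod_cast this
      obtain ⟨z, hz, hpz⟩ := exists_mulVec_eq_zero_pairVec_ne_zero φ R hR
        (sub_ne_zero.mpr huv) hweight
      refine sum_addChar_mulVec_fiber_eq_zero R _ hz (fun h => hpz ?_) y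
      change χ (pairVec φ (u - v) z) = 1 at h
      rw [← hχ, hω.pow_eq_one_iff_dvd] at h
      exact (ZMod.val_eq_zero _).mp (Nat.eq_zero_of_dvd_of_lt h (ZMod.val_lt _))
  ext a b
  simp only [Matrix.sum_apply, Matrix.smul_apply, outer, Matrix.of_apply, Finset.sum_apply,
    Pi.smul_apply, smul_eq_mul, map_sum, map_mul]
  simp_rw [sum_mul_sum]
  rw [sum_comm, mul_sum]
  refine sum_congr rfl fun u hu => ?_
  rw [sum_comm]
  have hinner : ∀ v ∈ univ.filter
        (fun u : Fin M → F => (hammingNorm u : ℝ) < ((M : ℝ) - m) / 2),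
      ∑ x with R.mulVec x = y, ω ^ (pairVec φ (u + w) x).val * ψ u a *
        ((starRingEnd ℂ) (ω ^ (pairVec φ (v + w) x).val) * (starRingEnd ℂ) (ψ v b)) =
      (if u = v then (p : ℂ) ^ (κ * (M - m)) else 0) *
        (ψ u a * (starRingEnd ℂ) (ψ v b)) := fun v hv => by
    rw [← hsum u hu v hv, sum_mul]
    exact sum_congr rfl fun x _ => mul_mul_mul_comm _ _ _ _
  rw [sum_congr rfl hinner]
  simp only [ite_mul, zero_mul, sum_ite_eq, if_pos hu]
end
end

section
/- Linear independence of columns of a polynomial interpolation matrix (Fact 2.2): Let K be a field, let d and s be natural numbers, and let x_0, …, x_d, t_1, …, t_s be d+1+s pairwise distinct elements of K. Let R be the s×(d+1) matrix over K characterized by the property that for every polynomial f ∈ K[X] of degree at most d, R applied to the vector (f(x_0), …, f(x_d)) equals the vector (f(t_1), …, f(t_s)) (i.e., R is the Lagrange interpolation matrix sending the values of a degree-≤d polynomial at the nodes x_0,…,x_d to its values at t_1,…,t_s). Then every set of s columns of R is linearly independent over K. -/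
open Finset

noncomputable section

/-- Linear independence of columns of a polynomial interpolation matrix (Fact 2.2):
if `x_0, …, x_d, t_1, …, t_s` are pairwise distinct elements of a field `K` and
`R` is the `s × (d+1)` Lagrange interpolation matrix sending the values of any
polynomial of degree at most `d` at the nodes `x_0, …, x_d` to its values at
`t_1, …, t_s`, then every set of `s` columns of `R` is linearly independent. -/
theorem interpolation_matrix_columns_linearIndependent
    (K : Type) [Field K] (d s : ℕ)
    (x : Fin (d + 1) → K) (t : Fin s → K)
    (hdist : Function.Injective (Sum.elim x t))
    (R : Matrix (Fin s) (Fin (d + 1)) K)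
    (hR : ∀ f : Polynomial K, f.natDegree ≤ d →
      R.mulVec (fun i => f.eval (x i)) = fun j => f.eval (t j))
    (J : Finset (Fin (d + 1))) (hJ : J.card = s) :
    LinearIndependent K (fun j : J => fun i : Fin s => R i (j : Fin (d + 1))) := by
  rw [Fintype.linearIndependent_iff]
  intro c hc
  let v : Fin (d + 1) → K := fun i => if h : i ∈ J then c ⟨i, h⟩ else 0
  let f := Lagrange.interpolate univ x v
  have hx : Function.Injective x := hdist.comp Sum.inl_injective
  have hfx (i : Fin (d + 1)) : f.eval (x i) = v i :=
    Lagrange.eval_interpolate_at_node v hx.injOn (mem_univ i)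
  have hdeg : f.natDegree ≤ d := by
    refine Polynomial.natDegree_le_iff_degree_le.2 ?_
    simpa [f] using Lagrange.degree_interpolate_le (s := univ) v hx.injOn
  have hft (j : Fin s) : f.eval (t j) = 0 := by
    refine (congrFun (hR f hdeg) j).symm.trans (Eq.trans ?_ (congrFun hc j))
    simp only [hfx, Matrix.mulVec, dotProduct, Finset.sum_apply, Pi.smul_apply, smul_eq_mul]
    rw [← sum_subset (subset_univ J) (fun i _ hi => by simp [v, hi]), ← sum_coe_sort J]
    exact sum_congr rfl fun i _ => by simp [v, mul_comm]
  have hf : f = 0 := by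
    refine Polynomial.eq_zero_of_natDegree_lt_card_of_eval_eq_zero f
      (f := fun a : {i // i ∉ J} ⊕ Fin s => Sum.elim x t (a.map Subtype.val id))
      (hdist.comp (Sum.map_injective.2 ⟨Subtype.val_injective, Function.injective_id⟩)) ?_ ?_
    · rintro (⟨i, hi⟩ | j)
      · simp [hfx, v, hi]
      · exact hft j
    · have hJd := card_le_univ J
      simp only [Fintype.card_fin] at hJd
      simp only [Fintype.card_sum, Fintype.card_subtype_compl, Fintype.card_coe,
        Fintype.card_fin]
      omega
  intro i
  simpa [hf, v] using (hfx i).symm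
end
end

section
/- Reconstruction-correctness parameter inequality for the adaptive-certified-deletion threshold scheme (arithmetic core of Lemma 6.2): Let n, k, λ be natural numbers with 1 ≤ k ≤ n and λ ≥ 1, regarded as real numbers. Define r := (λ + (n−k+1)·log λ)², t := (k+1)·r·(1 + (n−k+1)·log λ / λ) + 1, t' := t − r, ℓ := t·log λ / √r, and p := (k−1)·t' + (n−k+1)·ℓ. Then 2·k·r < k·t − p. (This says that the total number k·r of check positions contained in any k shares is strictly below the Reed–Solomon error-correction threshold (k·t − p)/2 for a degree-p polynomial evaluated at k·t points, which is exactly what is needed for reconstruction correctness of the scheme.) -/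
noncomputable section

/-- Reconstruction-correctness parameter inequality for the
adaptive-certified-deletion threshold scheme (arithmetic core of Lemma 6.2):
with `r = (λ + (n−k+1) log λ)²`, `t = (k+1) r (1 + (n−k+1) log λ / λ) + 1`,
`t' = t − r`, `ℓ = t log λ / √r`, and `p = (k−1) t' + (n−k+1) ℓ`, one has
`2 k r < k t − p`. -/
theorem reconstruction_parameter_inequality
    (n k lam : ℕ) (hk1 : 1 ≤ k) (hkn : k ≤ n) (hlam : 1 ≤ lam)
    (r t t' ℓ p : ℝ)
    (hr : r = ((lam : ℝ) + ((n : ℝ) - k + 1) * Real.log lam) ^ 2)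
    (ht : t = ((k : ℝ) + 1) * r *
      (1 + ((n : ℝ) - k + 1) * Real.log lam / (lam : ℝ)) + 1)
    (ht' : t' = t - r)
    (hℓ : ℓ = t * Real.log lam / Real.sqrt r)
    (hp : p = ((k : ℝ) - 1) * t' + ((n : ℝ) - k + 1) * ℓ) :
    2 * (k : ℝ) * r < (k : ℝ) * t - p := by
  have ha : (0 : ℝ) < lam := by exact_mod_cast hlam
  have hb : 0 ≤ ((n : ℝ) - k + 1) * Real.log lam := by
    have hkn' : (k : ℝ) ≤ n := by exact_mod_cast hkn
    exact mul_nonneg (by linarith) (Real.log_natCast_nonneg lam)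
  have hs : 0 < (lam : ℝ) + ((n : ℝ) - k + 1) * Real.log lam := by linarith
  have hsqrt : Real.sqrt r = (lam : ℝ) + ((n : ℝ) - k + 1) * Real.log lam := by
    rw [hr, Real.sqrt_sq hs.le]
  have hgap : (k : ℝ) * t - p - 2 * k * r =
      lam / ((lam : ℝ) + ((n : ℝ) - k + 1) * Real.log lam) := by
    rw [hp, ht', hℓ, hsqrt, ht, hr]
    field_simp
    ring
  have hpos := div_pos ha hs
  linarith
end
end

section
/- Reconstruction-correctness parameter inequality for the tighter parameter settings (arithmetic core of Lemma A.1): Let n, k, λ be natural numbers with 1 ≤ k ≤ n and λ ≥ 1, regarded as real numbers. Define r := λ + (n−k+1)²·(log λ)², t := (k+1)·r·(1 + (n−k+1)·log λ / (√r − (n−k+1)·log λ)) + 1, t' := t − r, ℓ := t·log λ / √r, and p := (k−1)·t' + (n−k+1)·ℓ. Then √r − (n−k+1)·log λ > 0 and 2·k·r < k·t − p. -/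
noncomputable section

/-- Reconstruction-correctness parameter inequality for the tighter parameter
settings (arithmetic core of Lemma A.1): with `r = λ + (n−k+1)² (log λ)²`,
`t = (k+1) r (1 + (n−k+1) log λ / (√r − (n−k+1) log λ)) + 1`, `t' = t − r`,
`ℓ = t log λ / √r`, and `p = (k−1) t' + (n−k+1) ℓ`, one has
`√r − (n−k+1) log λ > 0` and `2 k r < k t − p`. -/
theorem reconstruction_parameter_inequality_tight
    (n k lam : ℕ) (hk1 : 1 ≤ k) (hkn : k ≤ n) (hlam : 1 ≤ lam)
    (r t t' ℓ p : ℝ)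
    (hr : r = (lam : ℝ) + ((n : ℝ) - k + 1) ^ 2 * Real.log lam ^ 2)
    (ht : t = ((k : ℝ) + 1) * r *
      (1 + ((n : ℝ) - k + 1) * Real.log lam /
        (Real.sqrt r - ((n : ℝ) - k + 1) * Real.log lam)) + 1)
    (ht' : t' = t - r)
    (hℓ : ℓ = t * Real.log lam / Real.sqrt r)
    (hp : p = ((k : ℝ) - 1) * t' + ((n : ℝ) - k + 1) * ℓ) :
    Real.sqrt r - ((n : ℝ) - k + 1) * Real.log lam > 0 ∧
      2 * (k : ℝ) * r < (k : ℝ) * t - p := by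
  have hlam' : (1 : ℝ) ≤ lam := by exact_mod_cast hlam
  have hkn' : (k : ℝ) ≤ n := by exact_mod_cast hkn
  have ha : 0 ≤ ((n : ℝ) - k + 1) * Real.log lam :=
    mul_nonneg (by linarith) (Real.log_nonneg hlam')
  have has : ((n : ℝ) - k + 1) * Real.log lam < Real.sqrt r :=
    Real.lt_sqrt_of_sq_lt (by rw [hr, mul_pow]; linarith)
  have hs : 0 < Real.sqrt r := ha.trans_lt has
  have hd : 0 < Real.sqrt r - ((n : ℝ) - k + 1) * Real.log lam := sub_pos.2 has
  refine ⟨hd, ?_⟩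
  have hmℓ : ((n : ℝ) - k + 1) * ℓ =
      t * (((n : ℝ) - k + 1) * Real.log lam / Real.sqrt r) := by
    rw [hℓ]; ring
  rw [hp, ht', hmℓ]
  clear hr hℓ hp ht' hmℓ
  generalize ((n : ℝ) - k + 1) * Real.log lam = a at *
  generalize Real.sqrt r = s at *
  have key : t * (1 - a / s) = ((k : ℝ) + 1) * r + (s - a) / s := by
    have hs' := hs.ne'
    have hd' := hd.ne'
    rw [ht]
    field_simp
    ring
  have hpos : 0 < (s - a) / s := div_pos hd hs
  linarith
end
end
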